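/- Let G be a connected simple graph on Fin n with n ≥ 2, with m edges and diameter Δ. Suppose a and b are vertices with graph distance δ(a, b) = Δ, and suppose there exist κ ≥ 1 paths in G from a to b that are pairwise internally vertex-disjoint (no two of them share a vertex other than a and b). Then the algebraic connectivity satisfies a₁(G) ≤ 12·m / (κ·Δ·(Δ − 1)·(Δ − 2) + 6·Δ²). -/

import Mathlib

open Classical in
/-- The Laplacian quadratic form `⟨L(G) x, x⟩`. -/
noncomputable def lapQuad {m : ℕ} (G : SimpleGraph (Fin m)) (x : Fin m → ℝ) : ℝ :=
  ∑ i, (SimpleGraph.lapMatrix ℝ G).mulVec x i * x i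

/-- The algebraic connectivity `a₁(G)`: the minimum of the Rayleigh quotient
`⟨L(G)x, x⟩ / ⟨x, x⟩` over nonzero `x` with `∑ i, x i = 0` (for a connected graph on
at least two vertices this is the second-smallest Laplacian eigenvalue). -/
noncomputable def algConn {m : ℕ} (G : SimpleGraph (Fin m)) : ℝ :=
  sInf {r : ℝ | ∃ x : Fin m → ℝ, x ≠ 0 ∧ (∑ i, x i) = 0 ∧
    r = lapQuad G x / (∑ i, x i * x i)}

open Classical in
/-- The Laplacian quadratic form is half the sum of squared differences over ordered edges. -/
theorem lapQuad_eq {m : ℕ} (G : SimpleGraph (Fin m)) (x : Fin m → ℝ) :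
    lapQuad G x = (∑ i, ∑ j, if G.Adj i j then (x i - x j) ^ 2 else 0) / 2 := by
  rw [← SimpleGraph.lapMatrix_toLinearMap₂', Matrix.toLinearMap₂'_apply', dotProduct_comm]
  rfl

theorem lapQuad_nonneg {m : ℕ} (G : SimpleGraph (Fin m)) (x : Fin m → ℝ) :
    0 ≤ lapQuad G x := by
  classical
  rw [lapQuad_eq]
  refine div_nonneg (Finset.sum_nonneg fun i _ => Finset.sum_nonneg fun j _ => ?_) zero_le_two
  split_ifs <;> positivity

open Classical in
/-- If `x` varies by at most one along each edge, its quadratic form is at most the number of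
edges. -/
theorem lapQuad_le_card_edgeFinset {m : ℕ} (G : SimpleGraph (Fin m)) (x : Fin m → ℝ)
    (hx : ∀ i j, G.Adj i j → |x i - x j| ≤ 1) :
    lapQuad G x ≤ G.edgeFinset.card := by
  have hdeg : (∑ i, (G.degree i : ℝ)) = 2 * G.edgeFinset.card := by
    exact_mod_cast G.sum_degrees_eq_twice_card_edges
  have key : (∑ i, ∑ j, if G.Adj i j then (x i - x j) ^ 2 else 0) ≤ ∑ i, (G.degree i : ℝ) := by
    refine Finset.sum_le_sum fun i _ => ?_
    calc (∑ j, if G.Adj i j then (x i - x j) ^ 2 else 0)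
        ≤ ∑ j, if G.Adj i j then (1 : ℝ) else 0 := by
          refine Finset.sum_le_sum fun j _ => ?_
          split_ifs with h
          · exact (sq_le_one_iff_abs_le_one _).2 (hx i j h)
          · exact le_rfl
      _ = G.degree i := by
          rw [Finset.sum_boole, ← SimpleGraph.card_neighborFinset_eq_degree,
            SimpleGraph.neighborFinset_eq_filter]
  rw [lapQuad_eq]
  linarith

theorem algConn_le_div {m : ℕ} (G : SimpleGraph (Fin m)) (x : Fin m → ℝ) (hx : x ≠ 0)
    (hsum : ∑ i, x i = 0) : algConn G ≤ lapQuad G x / ∑ i, x i * x i := by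
  refine csInf_le ⟨0, ?_⟩ ⟨x, hx, hsum, rfl⟩
  rintro r ⟨y, -, -, rfl⟩
  exact div_nonneg (lapQuad_nonneg G y) (Finset.sum_nonneg fun i _ => mul_self_nonneg _)

/-- A walk meets every distance level from `a` lying between the levels of its endpoints. -/
theorem SimpleGraph.Connected.exists_mem_support_dist_eq {V : Type*} {G : SimpleGraph V}
    (hG : G.Connected) (a : V) {u v : V} (p : G.Walk u v) {j : ℕ}
    (hu : G.dist a u ≤ j) (hv : j ≤ G.dist a v) : ∃ x ∈ p.support, G.dist a x = j := by
  induction p with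
  | nil => exact ⟨_, by simp, le_antisymm hu hv⟩
  | @cons u w v h q ih =>
    by_cases hj : G.dist a u = j
    · exact ⟨u, by simp, hj⟩
    · have h1 : G.dist a w ≤ G.dist a u + G.dist u w := hG.dist_triangle
      rw [SimpleGraph.dist_eq_one_iff_adj.2 h] at h1
      obtain ⟨x, hx, hxj⟩ := ih (by omega) hv
      exact ⟨x, by simp [hx], hxj⟩

theorem SimpleGraph.Connected.abs_dist_sub_dist_le_one {V : Type*} {G : SimpleGraph V}
    (hG : G.Connected) (a : V) {u v : V} (h : G.Adj u v) :
    |(G.dist a u : ℝ) - G.dist a v| ≤ 1 := by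
  have h1 : G.dist a v ≤ G.dist a u + G.dist u v := hG.dist_triangle
  have h2 : G.dist a u ≤ G.dist a v + G.dist v u := hG.dist_triangle
  rw [SimpleGraph.dist_eq_one_iff_adj.2 h] at h1
  rw [SimpleGraph.dist_eq_one_iff_adj.2 h.symm] at h2
  rify at h1 h2
  rw [abs_le]
  constructor <;> linarith

/-- The sum of squared deviations of `1, …, N` from any real `c` is at least that from the
mean. -/
theorem le_sum_range_succ_sub_sq (N : ℕ) (c : ℝ) :
    (N : ℝ) * ((N : ℝ) ^ 2 - 1) / 12 ≤ ∑ j ∈ Finset.range N, ((j : ℝ) + 1 - c) ^ 2 := by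
  have h : ∑ j ∈ Finset.range N, ((j : ℝ) + 1 - c) ^ 2 =
      (N : ℝ) * ((N : ℝ) ^ 2 - 1) / 12 + N * (c - (N + 1) / 2) ^ 2 := by
    induction N with
    | zero => simp
    | succ N ih =>
      rw [Finset.sum_range_succ, ih]
      push_cast
      ring
  rw [h]
  exact le_add_of_nonneg_right (by positivity)

/-- Along `κ` internally disjoint `a`–`b` walks the distances to `a` spread out. -/
theorem SimpleGraph.Connected.le_sum_dist_sub_sq {V : Type*} [Fintype V] {G : SimpleGraph V}
    (hG : G.Connected) {a b : V} {D : ℕ} (hab : G.dist a b = D) (hD : 0 < D) {κ : ℕ}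
    (P : Fin κ → G.Walk a b)
    (hdisj : ∀ k l, k ≠ l → ∀ x : V,
      x ∈ (P k).support → x ∈ (P l).support → x = a ∨ x = b) (c : ℝ) :
    ((κ : ℝ) * D * ((D : ℝ) - 1) * ((D : ℝ) - 2) + 6 * (D : ℝ) ^ 2) / 12 ≤
      ∑ x, ((G.dist a x : ℝ) - c) ^ 2 := by
  classical
  have hex : ∀ (k : Fin κ) (j : Fin (D - 1)), ∃ x ∈ (P k).support, G.dist a x = j + 1 :=
    fun k j => hG.exists_mem_support_dist_eq a (P k) (by simp) (by omega)
  choose φ hφ hφd using hex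
  have hφa : ∀ k j, φ k j ≠ a := fun k j h => by
    have := hφd k j
    rw [h, SimpleGraph.dist_self] at this
    omega
  have hφb : ∀ k j, φ k j ≠ b := fun k j h => by
    have := hφd k j
    rw [h] at this
    omega
  have hinj : Function.Injective fun p : Fin κ × Fin (D - 1) => φ p.1 p.2 := by
    rintro ⟨k, i⟩ ⟨l, j⟩ h
    change φ k i = φ l j at h
    have hij : i = j := by
      have h1 := hφd k i
      rw [h, hφd l j] at h1
      exact Fin.ext (by omega)
    have hkl : k = l := by
      by_contra hkl
      rcases hdisj k l hkl _ (hφ k i) (h ▸ hφ l j) with h' | h'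
      · exact hφa _ _ h'
      · exact hφb _ _ h'
    rw [hij, hkl]
  have hne : a ≠ b := by
    rintro rfl
    rw [SimpleGraph.dist_self] at hab
    omega
  set S : Finset V := Finset.univ.image fun p : Fin κ × Fin (D - 1) => φ p.1 p.2 with hS
  have haS : a ∉ S := by simp [hS, hφa]
  have hbS : b ∉ S := by simp [hS, hφb]
  have hsumS : ∑ x ∈ S, ((G.dist a x : ℝ) - c) ^ 2 =
      κ * ∑ j ∈ Finset.range (D - 1), ((j : ℝ) + 1 - c) ^ 2 := by
    rw [hS, Finset.sum_image hinj.injOn, Fintype.sum_prod_type]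
    simp [hφd, Finset.sum_range]
  have hle : ∑ x ∈ insert a (insert b S), ((G.dist a x : ℝ) - c) ^ 2 ≤
      ∑ x, ((G.dist a x : ℝ) - c) ^ 2 :=
    Finset.sum_le_sum_of_subset_of_nonneg (Finset.subset_univ _) fun _ _ _ => sq_nonneg _
  rw [Finset.sum_insert (by simp [hne, haS]), Finset.sum_insert hbS, hsumS, hab,
    SimpleGraph.dist_self] at hle
  refine le_trans ?_ hle
  have h1 := mul_le_mul_of_nonneg_left (le_sum_range_succ_sub_sq (D - 1) c) κ.cast_nonneg (α := ℝ)
  rw [Nat.cast_sub hD] at h1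
  push_cast at h1 ⊢
  nlinarith [sq_nonneg ((D : ℝ) - 2 * c)]

open Classical in
/-- Let `G` be a connected graph on `n ≥ 2` vertices with `m` edges and
diameter `Δ`, let `a, b` be vertices at distance `Δ`, and suppose there are `κ ≥ 1`
pairwise internally vertex-disjoint paths from `a` to `b`. Then
`a₁(G) ≤ 12 m / (κ Δ (Δ-1) (Δ-2) + 6 Δ²)`. -/
theorem algConn_le_of_disjoint_paths (n : ℕ) (hn : 2 ≤ n)
    (G : SimpleGraph (Fin n)) (hG : G.Connected)
    (m : ℕ) (hm : m = G.edgeFinset.card)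
    (Δ : ℕ) (hΔ : Δ = G.diam)
    (a b : Fin n) (hab : G.dist a b = Δ)
    (κ : ℕ) (hκ : 1 ≤ κ)
    (P : Fin κ → G.Walk a b) (hP : ∀ k, (P k).IsPath)
    (hdisj : ∀ k l, k ≠ l → ∀ x : Fin n,
      x ∈ (P k).support → x ∈ (P l).support → x = a ∨ x = b) :
    algConn G ≤ 12 * (m : ℝ) /
      ((κ : ℝ) * (Δ : ℝ) * ((Δ : ℝ) - 1) * ((Δ : ℝ) - 2) + 6 * (Δ : ℝ) ^ 2) := by
  have : Nontrivial (Fin n) := Fin.nontrivial_iff_two_le.2 hn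
  have : Nonempty (Fin n) := ⟨a⟩
  have hD : 0 < Δ := by
    rw [hΔ, Nat.pos_iff_ne_zero]
    exact SimpleGraph.diam_ne_zero_of_ediam_ne_top (SimpleGraph.connected_iff_ediam_ne_top.1 hG)
  have hn0 : (n : ℝ) ≠ 0 := by positivity
  set c : ℝ := (∑ i, (G.dist a i : ℝ)) / n with hc
  have hsq := hG.le_sum_dist_sub_sq hab hD P hdisj c
  set B : ℝ := (κ : ℝ) * (Δ : ℝ) * ((Δ : ℝ) - 1) * ((Δ : ℝ) - 2) + 6 * (Δ : ℝ) ^ 2 with hB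
  have hBpos : 0 < B := by
    have h12 : 0 ≤ ((Δ : ℝ) - 1) * ((Δ : ℝ) - 2) := by
      rcases (show Δ = 1 ∨ 2 ≤ Δ by omega) with h | h
      · simp [h]
      · have : (2 : ℝ) ≤ Δ := by exact_mod_cast h
        exact mul_nonneg (by linarith) (by linarith)
    rw [hB, mul_assoc _ ((Δ : ℝ) - 1)]
    positivity
  let x : Fin n → ℝ := fun i => G.dist a i - c
  have hxx : ∑ i, x i * x i = ∑ i, ((G.dist a i : ℝ) - c) ^ 2 :=
    Finset.sum_congr rfl fun i _ => (sq _).symm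
  have hx0 : x ≠ 0 := by
    intro h
    rw [← hxx, h] at hsq
    simp at hsq
    linarith
  have hxsum : ∑ i, x i = 0 := by
    simp only [x, Finset.sum_sub_distrib, Finset.sum_const, Finset.card_univ, Fintype.card_fin,
      nsmul_eq_mul, hc]
    field_simp
    ring
  have hquad : lapQuad G x ≤ m := by
    rw [hm]
    refine lapQuad_le_card_edgeFinset G x fun i j hij => ?_
    simpa [x] using hG.abs_dist_sub_dist_le_one a hij
  calc algConn G ≤ lapQuad G x / ∑ i, x i * x i := algConn_le_div G x hx0 hxsum
    _ ≤ m / (B / 12) := by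
        rw [hxx]
        exact div_le_div₀ m.cast_nonneg hquad (by positivity) hsq
    _ = 12 * m / B := by
        field_simp
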